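/- Sharp Gagliardo–Nirenberg inequality for the Benjamin–Ono nonlinearity (m = 2): for every Schwartz function v : ℝ → ℝ, the principal value H v′(x) exists for every x, the quantity ∫_ℝ v(x) · (H v′)(x) dx is nonnegative, and ∫_ℝ |v(x)|³ dx ≤ (3/(2√π)) · ( ∫_ℝ v(x) · (H v′)(x) dx )^{1/2} · ∫_ℝ v(x)² dx. The constant 3/(2√π) is the sharp constant C₂ = (m(m+1)/2)·(2/((m−1)‖Q‖_{L²}²))^{(m−1)/2} for m = 2, where the ground state Q(x) = 4/(1+x²) has ‖Q‖_{L²}² = 8π. -/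

import Mathlib

open MeasureTheory Filter

/-- The principal value Hilbert transform of `f : ℝ → ℝ` at `x` exists and equals `A`. -/
def HilbertPVR (f : ℝ → ℝ) (x A : ℝ) : Prop :=
  Tendsto (fun ε : ℝ =>
      (1 / Real.pi) * ∫ y in {y : ℝ | ε < |x - y|}, f y / (x - y))
    (nhdsWithin 0 (Set.Ioi 0)) (nhds A)

section

open scoped FourierTransform ContDiff SchwartzMap ComplexInnerProductSpace ENNReal ComplexConjugate
open Set Topology

section Plancherel

theorem continuous_fourier_of_integrable {f : ℝ → ℂ} (hf : Integrable f) : Continuous (𝓕 f) :=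
  VectorFourier.fourierIntegral_continuous Real.continuous_fourierChar
    (by exact continuous_inner) hf

/-- The multiplication formula for the Fourier transform. -/
theorem integral_fourier_mul_eq {f g : ℝ → ℂ} (hf : Integrable f) (hg : Integrable g) :
    ∫ x, 𝓕 f x * g x = ∫ x, f x * 𝓕 g x := by
  simpa using! (VectorFourier.integral_fourierIntegral_smul_eq_flip (L := innerₗ ℝ)
    (μ := volume) (ν := volume) Real.continuous_fourierChar continuous_inner hf hg)

/-- On `L¹ ∩ L²` the `L²` Fourier transform is given by the Fourier integral. -/
theorem coeFn_fourier_toLp {f : ℝ → ℂ} (hf : Integrable f) (hf2 : MemLp f 2) :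
    (𝓕 (hf2.toLp f) : Lp ℂ 2 (volume : Measure ℝ)) =ᵐ[volume] 𝓕 f := by
  have hcont := continuous_fourier_of_integrable hf
  refine ae_eq_of_integral_contDiff_smul_eq
    ((Lp.memLp _).locallyIntegrable (by norm_num)) hcont.locallyIntegrable fun g hg hgc => ?_
  have hg₁ : HasCompactSupport (Complex.ofRealCLM ∘ g) := hgc.comp_left rfl
  have hg₂ : ContDiff ℝ ∞ (Complex.ofRealCLM ∘ g) := by fun_prop
  set G : 𝓢(ℝ, ℂ) := hg₁.toSchwartzMap hg₂
  have hG : ∀ x, G x = (g x : ℂ) := fun x => rfl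
  have h := congrArg (fun T => T G) (Lp.fourier_toTemperedDistribution_eq (hf2.toLp f))
  simp only [TemperedDistribution.fourier_apply, Lp.toTemperedDistribution_apply] at h
  have e1 : ∫ x, (𝓕 G) x • (hf2.toLp f) x = ∫ x, 𝓕 (⇑G) x * f x := by
    refine integral_congr_ae ?_
    filter_upwards [hf2.coeFn_toLp] with x hx
    rw [hx, SchwartzMap.fourier_coe, smul_eq_mul]
  rw [e1, integral_fourier_mul_eq G.integrable hf] at h
  simpa [hG, Complex.real_smul] using h.symm

theorem memLp_fourier {f : ℝ → ℂ} (hf : Integrable f) (hf2 : MemLp f 2) : MemLp (𝓕 f) 2 :=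
  (memLp_congr_ae (coeFn_fourier_toLp hf hf2)).1 (Lp.memLp _)

/-- Parseval's identity on `L¹ ∩ L²`. -/
theorem integral_fourier_mul_conj {f g : ℝ → ℂ} (hf : Integrable f) (hf2 : MemLp f 2)
    (hg : Integrable g) (hg2 : MemLp g 2) :
    ∫ x, 𝓕 f x * conj (𝓕 g x) = ∫ x, f x * conj (g x) := by
  have h := Lp.inner_fourier_eq (hg2.toLp g) (hf2.toLp f)
  rw [L2.inner_def, L2.inner_def] at h
  have e1 : ∫ x, 𝓕 f x * conj (𝓕 g x) =
      ∫ x, ⟪(𝓕 (hg2.toLp g) : Lp ℂ 2 (volume : Measure ℝ)) x,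
        (𝓕 (hf2.toLp f) : Lp ℂ 2 (volume : Measure ℝ)) x⟫ := by
    refine integral_congr_ae ?_
    filter_upwards [coeFn_fourier_toLp hf hf2, coeFn_fourier_toLp hg hg2] with x h1 h2
    rw [h1, h2, RCLike.inner_apply]
  have e2 : ∫ x, f x * conj (g x) = ∫ x, ⟪(hg2.toLp g) x, (hf2.toLp f) x⟫ := by
    refine integral_congr_ae ?_
    filter_upwards [hf2.coeFn_toLp, hg2.coeFn_toLp] with x h1 h2
    rw [h1, h2, RCLike.inner_apply]
  rw [e1, e2, h]

/-- Plancherel's identity on `L¹ ∩ L²`. -/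
theorem integral_norm_fourier_sq {f : ℝ → ℂ} (hf : Integrable f) (hf2 : MemLp f 2) :
    ∫ x, ‖𝓕 f x‖ ^ 2 = ∫ x, ‖f x‖ ^ 2 := by
  have h := integral_fourier_mul_conj hf hf2 hf hf2
  simp only [Complex.mul_conj', ← Complex.ofReal_pow, integral_complex_ofReal] at h
  exact_mod_cast h

/-- Plancherel's identity on `L¹ ∩ L²`, for lower Lebesgue integrals. -/
theorem lintegral_enorm_fourier_sq {f : ℝ → ℂ} (hf : Integrable f) (hf2 : MemLp f 2) :
    ∫⁻ x, ‖𝓕 f x‖ₑ ^ 2 = ∫⁻ x, ‖f x‖ₑ ^ 2 := by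
  have key : ∀ g : ℝ → ℂ, MemLp g 2 → ∫⁻ x, ‖g x‖ₑ ^ 2 = ENNReal.ofReal (∫ x, ‖g x‖ ^ 2) := by
    intro g hg
    rw [ofReal_integral_eq_lintegral_ofReal (hg.integrable_norm_pow (by norm_num))
      (ae_of_all _ fun x => by positivity)]
    exact lintegral_congr fun x => by rw [ENNReal.ofReal_pow (norm_nonneg _), ofReal_norm]
  rw [key _ (memLp_fourier hf hf2), key _ hf2, integral_norm_fourier_sq hf hf2]

end Plancherel

section Hardy

open scoped Convolution
open ContinuousLinearMap (mul)

/-- Cauchy–Schwarz for lower Lebesgue integrals. -/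
theorem sq_lintegral_mul_le {α : Type*} [MeasurableSpace α] {μ : Measure α} {f g : α → ℝ≥0∞}
    (hf : AEMeasurable f μ) (hg : AEMeasurable g μ) :
    (∫⁻ x, f x * g x ∂μ) ^ 2 ≤ (∫⁻ x, f x ^ 2 ∂μ) * ∫⁻ x, g x ^ 2 ∂μ := by
  have h := ENNReal.lintegral_mul_le_Lp_mul_Lq μ Real.HolderConjugate.two_two hf hg
  have h2 := pow_le_pow_left' h 2
  simp only [Pi.mul_apply, mul_pow] at h2
  have e : ∀ y : ℝ≥0∞, (y ^ (1 / (2 : ℝ))) ^ 2 = y := fun y => by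
    rw [← ENNReal.rpow_natCast, ← ENNReal.rpow_mul]; norm_num
  simpa only [e, ENNReal.rpow_ofNat] using h2

variable {b : ℝ → ℂ}

theorem convolution_self_apply_eq_zero (hb0 : ∀ ξ ≤ 0, b ξ = 0) {ξ : ℝ} (hξ : ξ ≤ 0) :
    (b ⋆[mul ℂ ℂ] b) ξ = 0 := by
  rw [convolution_def, ← integral_zero ℝ ℂ]
  congr 1 with η
  rcases le_total η 0 with h | h
  · simp [hb0 η h]
  · simp [hb0 (ξ - η) (by linarith)]

theorem enorm_convolution_self_sq_le (hbm : Measurable b) (hb0 : ∀ ξ ≤ 0, b ξ = 0) (ξ : ℝ) :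
    ‖(b ⋆[mul ℂ ℂ] b) ξ‖ₑ ^ 2 ≤
      ∫⁻ η, (ENNReal.ofReal η + ENNReal.ofReal (ξ - η)) * (‖b η‖ₑ ^ 2 * ‖b (ξ - η)‖ₑ ^ 2) := by
  set G : ℝ → ℝ≥0∞ := fun η => ‖b η‖ₑ * ‖b (ξ - η)‖ₑ
  have hG : Measurable G := by fun_prop
  have h1 : ‖(b ⋆[mul ℂ ℂ] b) ξ‖ₑ ≤ ∫⁻ η, (Ioo 0 ξ).indicator 1 η * G η := by
    rw [convolution_def]
    refine (enorm_integral_le_lintegral_enorm _).trans (lintegral_mono fun η => ?_)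
    by_cases hη : η ∈ Ioo 0 ξ
    · simp [hη, G]
    · have : b η * b (ξ - η) = 0 := by
        rcases le_or_gt η 0 with h | h
        · simp [hb0 η h]
        · rw [hb0 (ξ - η) (by by_contra! h'; exact hη ⟨h, by linarith⟩), mul_zero]
      simp [this]
  calc ‖(b ⋆[mul ℂ ℂ] b) ξ‖ₑ ^ 2
      ≤ (∫⁻ η, (Ioo 0 ξ).indicator 1 η ^ 2) * ∫⁻ η, G η ^ 2 :=
        (pow_le_pow_left' h1 2).trans (sq_lintegral_mul_le
          ((measurable_one.indicator measurableSet_Ioo).aemeasurable) hG.aemeasurable)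
    _ = ENNReal.ofReal ξ * ∫⁻ η, G η ^ 2 := by
        congr 1
        have : (fun η => (Ioo 0 ξ).indicator (1 : ℝ → ℝ≥0∞) η ^ 2) = (Ioo 0 ξ).indicator 1 := by
          ext η; by_cases hη : η ∈ Ioo 0 ξ <;> simp [hη]
        rw [this, lintegral_indicator_one measurableSet_Ioo, Real.volume_Ioo, sub_zero]
    _ = ∫⁻ η, ENNReal.ofReal ξ * G η ^ 2 := (lintegral_const_mul _ (by fun_prop)).symm
    _ ≤ _ := by
        refine lintegral_mono fun η => ?_
        simp only [G, mul_pow]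
        gcongr
        simpa using ENNReal.ofReal_add_le (p := η) (q := ξ - η)

theorem lintegral_enorm_convolution_self_sq_le (hbm : Measurable b)
    (hb0 : ∀ ξ ≤ 0, b ξ = 0) :
    ∫⁻ ξ, ‖(b ⋆[mul ℂ ℂ] b) ξ‖ₑ ^ 2 ≤
      2 * (∫⁻ η, ‖b η‖ₑ ^ 2) * ∫⁻ η, ENNReal.ofReal η * ‖b η‖ₑ ^ 2 := by
  set A := ∫⁻ η, ‖b η‖ₑ ^ 2
  set B := ∫⁻ η, ENNReal.ofReal η * ‖b η‖ₑ ^ 2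
  calc _ ≤ ∫⁻ ξ, ∫⁻ η, (ENNReal.ofReal η + ENNReal.ofReal (ξ - η)) *
            (‖b η‖ₑ ^ 2 * ‖b (ξ - η)‖ₑ ^ 2) :=
          lintegral_mono fun ξ => enorm_convolution_self_sq_le hbm hb0 ξ
    _ = ∫⁻ η, ∫⁻ ξ, (ENNReal.ofReal η + ENNReal.ofReal (ξ - η)) *
            (‖b η‖ₑ ^ 2 * ‖b (ξ - η)‖ₑ ^ 2) := lintegral_lintegral_swap (by fun_prop)
    _ = ∫⁻ η, ∫⁻ ζ, (ENNReal.ofReal η + ENNReal.ofReal ζ) * (‖b η‖ₑ ^ 2 * ‖b ζ‖ₑ ^ 2) := by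
        refine lintegral_congr fun η => ?_
        exact lintegral_sub_right_eq_self (μ := volume) (fun ζ => (ENNReal.ofReal η +
          ENNReal.ofReal ζ) * (‖b η‖ₑ ^ 2 * ‖b ζ‖ₑ ^ 2)) η
    _ = ∫⁻ η, (ENNReal.ofReal η * ‖b η‖ₑ ^ 2 * A + ‖b η‖ₑ ^ 2 * B) := by
        refine lintegral_congr fun η => ?_
        rw [← lintegral_const_mul _ (by fun_prop), ← lintegral_const_mul _ (by fun_prop),
          ← lintegral_add_left (by fun_prop)]
        exact lintegral_congr fun ζ => by ring
    _ = 2 * A * B := by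
        rw [lintegral_add_left (by fun_prop), lintegral_mul_const _ (by fun_prop),
          lintegral_mul_const _ (by fun_prop)]
        ring

theorem memLp_two_of_lintegral_ne_top {f : ℝ → ℂ} (hf : AEStronglyMeasurable f)
    (h : ∫⁻ η, ‖f η‖ₑ ^ 2 ≠ ⊤) : MemLp f 2 := by
  refine ⟨hf, ?_⟩
  rw [eLpNorm_lt_top_iff_lintegral_rpow_enorm_lt_top (by norm_num) (by norm_num)]
  simpa only [ENNReal.toReal_ofNat, ENNReal.rpow_ofNat] using h.lt_top

theorem memLp_convolution_self (hbm : Measurable b) (hb0 : ∀ ξ ≤ 0, b ξ = 0)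
    (hb : Integrable b) (hA : ∫⁻ η, ‖b η‖ₑ ^ 2 ≠ ⊤)
    (hB : ∫⁻ η, ENNReal.ofReal η * ‖b η‖ₑ ^ 2 ≠ ⊤) : MemLp (b ⋆[mul ℂ ℂ] b) 2 := by
  refine memLp_two_of_lintegral_ne_top
    (hb.integrable_convolution (mul ℂ ℂ) hb).aestronglyMeasurable
    ((lintegral_enorm_convolution_self_sq_le hbm hb0).trans_lt
      (ENNReal.mul_lt_top (ENNReal.mul_lt_top (by norm_num) hA.lt_top) hB.lt_top)).ne

/-- The sharp `L⁴` bound for functions with nonnegative frequencies. -/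
theorem lintegral_enorm_fourier_pow_four_le (hbm : Measurable b) (hb0 : ∀ ξ ≤ 0, b ξ = 0)
    (hb : Integrable b) (hA : ∫⁻ η, ‖b η‖ₑ ^ 2 ≠ ⊤)
    (hB : ∫⁻ η, ENNReal.ofReal η * ‖b η‖ₑ ^ 2 ≠ ⊤) :
    ∫⁻ x, ‖𝓕 b x‖ₑ ^ 4 ≤ 2 * (∫⁻ η, ‖b η‖ₑ ^ 2) * ∫⁻ η, ENNReal.ofReal η * ‖b η‖ₑ ^ 2 := by
  rw [show ∫⁻ x, ‖𝓕 b x‖ₑ ^ 4 = ∫⁻ x, ‖𝓕 (b ⋆[mul ℂ ℂ] b) x‖ₑ ^ 2 from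
    lintegral_congr fun x => by
      rw [Real.fourier_mul_convolution_eq hb hb, enorm_mul]; ring,
    lintegral_enorm_fourier_sq (hb.integrable_convolution (mul ℂ ℂ) hb)
      (memLp_convolution_self hbm hb0 hb hA hB)]
  exact lintegral_enorm_convolution_self_sq_le hbm hb0

theorem fourier_conj_comp_neg (f : ℝ → ℂ) (x : ℝ) :
    𝓕 (fun ξ => conj (f (-ξ))) x = conj (𝓕 f x) := by
  rw [Real.fourier_eq, Real.fourier_eq, ← integral_conj, ← integral_neg_eq_self]
  refine integral_congr_ae (ae_of_all _ fun ξ => ?_)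
  simp [Circle.smul_def, ← Circle.coe_inv_eq_conj, ← AddChar.map_neg_eq_inv]

/-- The cube of a function with positive frequencies has vanishing integral. -/
theorem integral_fourier_pow_three (hbm : Measurable b) (hb0 : ∀ ξ ≤ 0, b ξ = 0)
    (hb : Integrable b) (hA : ∫⁻ η, ‖b η‖ₑ ^ 2 ≠ ⊤)
    (hB : ∫⁻ η, ENNReal.ofReal η * ‖b η‖ₑ ^ 2 ≠ ⊤) :
    ∫ x, 𝓕 b x ^ 3 = 0 := by
  have hr : Integrable (fun ξ => conj (b (-ξ))) :=
    (Complex.conjCLE.toContinuousLinearMap.integrable_comp hb.comp_neg)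
  have hr2 : MemLp (fun ξ => conj (b (-ξ))) 2 := by
    refine memLp_two_of_lintegral_ne_top hr.aestronglyMeasurable ?_
    simpa [lintegral_neg_eq_self (μ := volume) (fun η => ‖b η‖ₑ ^ 2)] using hA
  have h := integral_fourier_mul_conj (hb.integrable_convolution (mul ℂ ℂ) hb)
    (memLp_convolution_self hbm hb0 hb hA hB) hr hr2
  simp only [fourier_conj_comp_neg, Complex.conj_conj,
    Real.fourier_mul_convolution_eq hb hb] at h
  rw [show (fun x => 𝓕 b x ^ 3) = fun x => 𝓕 b x * 𝓕 b x * 𝓕 b x by ext; ring, h,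
    ← integral_zero ℝ ℂ]
  congr 1 with ξ
  rcases le_total ξ 0 with h | h
  · simp [convolution_self_apply_eq_zero hb0 h]
  · simp [hb0 (-ξ) (by linarith)]

end Hardy

section RealValued

theorem fourier_ofReal_neg (w : ℝ → ℝ) (ξ : ℝ) :
    𝓕 (fun x => (w x : ℂ)) (-ξ) = conj (𝓕 (fun x => (w x : ℂ)) ξ) := by
  rw [Real.fourier_eq, Real.fourier_eq, ← integral_conj]
  refine integral_congr_ae (ae_of_all _ fun x => ?_)
  simp [Circle.smul_def, ← Circle.coe_inv_eq_conj, ← AddChar.map_neg_eq_inv]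

/-- The negative frequency part of the Fourier transform of `w`, reflected to the positive axis. -/
noncomputable def hardyPart (w : ℝ → ℝ) : ℝ → ℂ :=
  (Ioi 0).indicator fun ξ => 𝓕 (fun x => (w x : ℂ)) (-ξ)

variable {w : ℝ → ℝ}

theorem hardyPart_of_nonpos {ξ : ℝ} (hξ : ξ ≤ 0) : hardyPart w ξ = 0 :=
  indicator_of_notMem (by simpa using hξ) _

theorem hardyPart_of_pos {ξ : ℝ} (hξ : 0 < ξ) :
    hardyPart w ξ = 𝓕 (fun x => (w x : ℂ)) (-ξ) :=
  indicator_of_mem (by simpa using hξ) _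

theorem measurable_hardyPart (hw : Integrable w) : Measurable (hardyPart w) :=
  ((continuous_fourier_of_integrable hw.ofReal).comp continuous_neg).measurable.indicator
    measurableSet_Ioi

theorem integrable_hardyPart (hW : Integrable (𝓕 fun x => (w x : ℂ))) :
    Integrable (hardyPart w) :=
  hW.comp_neg.indicator measurableSet_Ioi

theorem eq_two_mul_re_fourier_hardyPart (hwc : Continuous w) (hw : Integrable w)
    (hW : Integrable (𝓕 fun x => (w x : ℂ))) (x : ℝ) :
    w x = 2 * (𝓕 (hardyPart w) x).re := by
  have hb := integrable_hardyPart hW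
  have hr : Integrable (fun ξ => conj (hardyPart w (-ξ))) :=
    Complex.conjCLE.toContinuousLinearMap.integrable_comp hb.comp_neg
  have h1 : 𝓕⁻ (𝓕 fun x => (w x : ℂ)) = fun x => (w x : ℂ) :=
    (Complex.continuous_ofReal.comp hwc).fourierInv_fourier_eq hw.ofReal hW
  have h2 : 𝓕⁻ (𝓕 fun x => (w x : ℂ)) x
      = 𝓕 (fun ξ => hardyPart w ξ + conj (hardyPart w (-ξ))) x := by
    rw [Real.fourierInv_eq_fourier_comp_neg]
    refine Real.fourier_congr_ae ?_ x
    filter_upwards [compl_mem_ae_iff.2 (measure_singleton (0 : ℝ))] with ξ hξ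
    rcases lt_or_gt_of_ne (show ξ ≠ 0 from hξ) with h | h
    · rw [hardyPart_of_nonpos h.le, hardyPart_of_pos (by linarith : 0 < -ξ), ← fourier_ofReal_neg]
      simp
    · rw [hardyPart_of_pos h, hardyPart_of_nonpos (by linarith : -ξ ≤ 0)]
      simp
  have h3 : 𝓕 (fun ξ => hardyPart w ξ + conj (hardyPart w (-ξ))) x
      = 𝓕 (hardyPart w) x + conj (𝓕 (hardyPart w) x) := by
    rw [← fourier_conj_comp_neg]
    simp only [Real.fourier_eq, smul_add]
    exact integral_add ((Real.fourierIntegral_convergent_iff x).2 hb)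
      ((Real.fourierIntegral_convergent_iff x).2 hr)
  have h4 := congrFun h1 x
  rw [h2, h3, Complex.add_conj] at h4
  exact_mod_cast h4.symm

theorem lintegral_fourier_eq_two_mul_hardyPart (hw : Integrable w) {φ : ℝ → ℝ≥0∞}
    (hφ : Measurable φ) :
    ∫⁻ ξ, φ |ξ| * ‖𝓕 (fun x => (w x : ℂ)) ξ‖ₑ ^ 2 =
      2 * ∫⁻ ξ, φ ξ * ‖hardyPart w ξ‖ₑ ^ 2 := by
  have hm := measurable_hardyPart hw
  calc _ = ∫⁻ ξ, (φ ξ * ‖hardyPart w ξ‖ₑ ^ 2 + φ (-ξ) * ‖hardyPart w (-ξ)‖ₑ ^ 2) := by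
        refine lintegral_congr_ae ?_
        filter_upwards [compl_mem_ae_iff.2 (measure_singleton (0 : ℝ))] with ξ hξ
        rcases lt_or_gt_of_ne (show ξ ≠ 0 from hξ) with h | h
        · rw [hardyPart_of_nonpos h.le, hardyPart_of_pos (by linarith : 0 < -ξ), abs_of_neg h]
          simp
        · rw [hardyPart_of_pos h, hardyPart_of_nonpos (by linarith : -ξ ≤ 0), abs_of_pos h,
            fourier_ofReal_neg]
          simp
    _ = _ := by
        rw [lintegral_add_left (by fun_prop),
          lintegral_neg_eq_self (μ := volume) fun ξ => φ ξ * ‖hardyPart w ξ‖ₑ ^ 2, two_mul]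

/-- The sharp Gagliardo–Nirenberg inequality for `∫ w³`, with the seminorm on the Fourier side. -/
theorem integral_pow_three_le (hwc : Continuous w) (hw : Integrable w) (hw2 : MemLp w 2)
    (hW : Integrable (𝓕 fun x => (w x : ℂ)))
    (hN : ∫⁻ ξ, ENNReal.ofReal |ξ| * ‖𝓕 (fun x => (w x : ℂ)) ξ‖ₑ ^ 2 ≠ ⊤) :
    ∫ x, w x ^ 3 ≤ 3 * √((∫⁻ ξ, ENNReal.ofReal |ξ| *
      ‖𝓕 (fun x => (w x : ℂ)) ξ‖ₑ ^ 2).toReal / 2) * ∫ x, w x ^ 2 := by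
  set b := hardyPart w with hbdef
  set N := ∫⁻ ξ, ENNReal.ofReal |ξ| * ‖𝓕 (fun x => (w x : ℂ)) ξ‖ₑ ^ 2
  set M := ∫ x, w x ^ 2
  have hM0 : 0 ≤ M := integral_nonneg fun x => sq_nonneg _
  have hbm : Measurable b := measurable_hardyPart hw
  have hb0 : ∀ ξ ≤ 0, b ξ = 0 := fun ξ hξ => hardyPart_of_nonpos hξ
  have hb : Integrable b := integrable_hardyPart hW
  have hM : 2 * ∫⁻ η, ‖b η‖ₑ ^ 2 = ENNReal.ofReal M := by
    have h := lintegral_fourier_eq_two_mul_hardyPart hw (φ := fun _ => 1) measurable_const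
    simp only [one_mul] at h
    have hwC : Integrable (fun x => (w x : ℂ)) := hw.ofReal
    have hwC2 : MemLp (fun x => (w x : ℂ)) 2 := hw2.ofReal
    rw [← h, lintegral_enorm_fourier_sq hwC hwC2,
      ofReal_integral_eq_lintegral_ofReal hw2.integrable_sq (ae_of_all _ fun x => sq_nonneg _)]
    refine lintegral_congr fun x => ?_
    rw [← sq_abs, ENNReal.ofReal_pow (abs_nonneg _), ← Real.norm_eq_abs, ofReal_norm,
      ← ofReal_norm, Complex.norm_real, ofReal_norm]
  have hNb : 2 * ∫⁻ η, ENNReal.ofReal η * ‖b η‖ₑ ^ 2 = N :=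
    (lintegral_fourier_eq_two_mul_hardyPart hw ENNReal.measurable_ofReal).symm
  have hA : ∫⁻ η, ‖b η‖ₑ ^ 2 ≠ ⊤ := fun h => by simp [h] at hM
  have hB : ∫⁻ η, ENNReal.ofReal η * ‖b η‖ₑ ^ 2 ≠ ⊤ := fun h => by
    rw [h] at hNb; exact hN (by simp [← hNb])
  set F := 𝓕 b with hF
  have hFc : Continuous F := continuous_fourier_of_integrable hb
  have hF2 : MemLp F 2 :=
    memLp_fourier hb (memLp_two_of_lintegral_ne_top hb.aestronglyMeasurable hA)
  have hF4 : ∫⁻ x, ‖F x ^ 2‖ₑ ^ 2 ≤ ENNReal.ofReal (M * (N.toReal / 2)) := by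
    calc _ = ∫⁻ x, ‖F x‖ₑ ^ 4 := lintegral_congr fun x => by rw [enorm_pow]; ring
      _ ≤ _ := lintegral_enorm_fourier_pow_four_le hbm hb0 hb hA hB
      _ = _ := by
        rw [hM, ENNReal.ofReal_mul hM0, ENNReal.ofReal_div_of_pos two_pos, ENNReal.ofReal_toReal hN,
          ← hNb, ENNReal.ofReal_ofNat, mul_comm 2, ENNReal.mul_div_cancel_right (by simp) (by simp)]
  have hFF : MemLp (fun x => F x ^ 2) 2 :=
    memLp_two_of_lintegral_ne_top (hFc.pow 2).aestronglyMeasurable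
      (hF4.trans_lt ENNReal.ofReal_lt_top).ne
  have hFF' : MemLp (fun x => ‖F x‖ ^ 2) 2 := by simpa using hFF.norm
  have hF4' : ∫ x, (‖F x‖ ^ 2) ^ 2 ≤ M * (N.toReal / 2) := by
    rw [integral_eq_lintegral_of_nonneg_ae (ae_of_all _ fun x => by positivity)
      (by fun_prop)]
    refine ENNReal.toReal_le_of_le_ofReal (by positivity) (le_trans (le_of_eq ?_) hF4)
    refine lintegral_congr fun x => ?_
    rw [ENNReal.ofReal_pow (by positivity), ENNReal.ofReal_pow (by positivity), ofReal_norm,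
      enorm_pow]
  have hF3 : Integrable (fun x => F x ^ 3) := by
    have := hFF.integrable_mul hF2
    exact this.congr (ae_of_all _ fun x => by simp only [Pi.mul_apply]; ring)
  have hFw : Integrable (fun x => ‖F x‖ ^ 2 * w x) := hFF'.integrable_mul hw2
  have hw3 : ∀ x, w x ^ 3 = 2 * (F x ^ 3).re + 3 * (‖F x‖ ^ 2 * w x) := fun x => by
    have := eq_two_mul_re_fourier_hardyPart hwc hw hW x
    rw [this, ← Complex.normSq_eq_norm_sq, Complex.normSq_apply]
    simp only [pow_succ, pow_zero, one_mul, Complex.mul_re, Complex.mul_im, ← hbdef, ← hF]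
    ring
  have hcs : ∫ x, ‖F x‖ ^ 2 * w x ≤ √(∫ x, (‖F x‖ ^ 2) ^ 2) * √M := by
    have h := integral_mul_norm_le_Lp_mul_Lq (μ := volume) Real.HolderConjugate.two_two
      (f := fun x => ‖F x‖ ^ 2) (g := w) (by simpa using hFF') (by simpa using hw2)
    simp only [Real.sqrt_eq_rpow]
    refine (integral_mono hFw (hFF'.norm.integrable_mul hw2.norm) fun x => ?_).trans
      (h.trans (le_of_eq ?_))
    · simp only [Pi.mul_apply, norm_pow, norm_norm]
      gcongr
      exact Real.le_norm_self _
    · simp [M]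
  calc ∫ x, w x ^ 3 = 2 * (∫ x, (F x ^ 3).re) + 3 * ∫ x, ‖F x‖ ^ 2 * w x := by
        simp_rw [hw3]
        have hre : Integrable (fun x => (F x ^ 3).re) := hF3.re
        rw [integral_add (hre.const_mul 2) (hFw.const_mul 3), integral_const_mul,
          integral_const_mul]
    _ = 3 * ∫ x, ‖F x‖ ^ 2 * w x := by
        have : ∫ x, (F x ^ 3).re = 0 := by
          have h := integral_re hF3
          rw [integral_fourier_pow_three hbm hb0 hb hA hB] at h
          simpa using h
        rw [this]; ring
    _ ≤ 3 * (√(M * (N.toReal / 2)) * √M) := by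
        gcongr
        exact hcs.trans (by gcongr)
    _ = _ := by
        rw [Real.sqrt_mul hM0]
        linear_combination 3 * √(N.toReal / 2) * Real.mul_self_sqrt hM0

end RealValued

section SineKernel

theorem lintegral_eq_two_mul_setLIntegral_Ioi {f : ℝ → ℝ≥0∞} (hf : Measurable f)
    (heven : ∀ t, f (-t) = f t) : ∫⁻ t, f t = 2 * ∫⁻ t in Ioi 0, f t := by
  set g := (Ioi (0 : ℝ)).indicator f
  have hg : Measurable g := hf.indicator measurableSet_Ioi
  calc ∫⁻ t, f t = ∫⁻ t, (g t + g (-t)) := by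
        refine lintegral_congr_ae ?_
        filter_upwards [compl_mem_ae_iff.2 (measure_singleton (0 : ℝ))] with t ht
        rcases lt_or_gt_of_ne (show t ≠ 0 from ht) with h | h
        · simp [g, h, h.le, heven]
        · simp [g, h, h.le]
    _ = 2 * ∫⁻ t in Ioi 0, f t := by
        rw [lintegral_add_left hg, lintegral_neg_eq_self (μ := volume) g,
          lintegral_indicator measurableSet_Ioi, two_mul]

theorem fourier_indicator_Ioc {a : ℝ} (ha : 0 ≤ a) {t : ℝ} (ht : t ≠ 0) :
    𝓕 ((Ioc 0 a).indicator (1 : ℝ → ℂ)) t =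
      (Complex.exp (Complex.I * ((-2 * Real.pi * t * a : ℝ) : ℂ)) - 1) /
        ((-2 * Real.pi * t : ℝ) * Complex.I) := by
  have hc : (((-2 * Real.pi * t : ℝ) : ℂ) * Complex.I) ≠ 0 := by
    simp [ht, Real.pi_ne_zero]
  have h := integral_exp_mul_complex (a := 0) (b := a) hc
  rw [Real.fourier_real_eq_integral_exp_smul]
  rw [intervalIntegral.integral_of_le ha, ← integral_indicator measurableSet_Ioc] at h
  rw [show Complex.I * ((-2 * Real.pi * t * a : ℝ) : ℂ) =
    ((-2 * Real.pi * t : ℝ) : ℂ) * Complex.I * a by push_cast; ring]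
  simp only [Complex.ofReal_zero, mul_zero, Complex.exp_zero] at h
  rw [← h]
  congr 1 with x
  by_cases hx : x ∈ Ioc 0 a
  · simp only [indicator_of_mem hx, Pi.one_apply, smul_eq_mul, mul_one]
    congr 1; push_cast; ring
  · simp [indicator_of_notMem hx]

theorem lintegral_sin_sq_div_sq (ξ : ℝ) :
    ∫⁻ t, ENNReal.ofReal ((2 * Real.sin (Real.pi * t * ξ)) ^ 2 / t ^ 2) =
      ENNReal.ofReal (4 * Real.pi ^ 2 * |ξ|) := by
  set f : ℝ → ℂ := (Ioc 0 |ξ|).indicator 1 with hf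
  have hfi : Integrable f := (integrable_indicator_iff measurableSet_Ioc).2
    (integrableOn_const (by simp))
  have hfsq : ∫⁻ x, ‖f x‖ₑ ^ 2 = ENNReal.ofReal |ξ| := by
    rw [show (fun x => ‖f x‖ₑ ^ 2) = (Ioc 0 |ξ|).indicator 1 by
      ext x; by_cases hx : x ∈ Ioc 0 |ξ| <;> simp [f, hx],
      lintegral_indicator_one measurableSet_Ioc, Real.volume_Ioc, sub_zero]
  have hf2 : MemLp f 2 := memLp_two_of_lintegral_ne_top hfi.aestronglyMeasurable
    (hfsq ▸ ENNReal.ofReal_ne_top)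
  rw [ENNReal.ofReal_mul (by positivity), ← hfsq, ← lintegral_enorm_fourier_sq hfi hf2,
    ← lintegral_const_mul _ (by
      have := continuous_fourier_of_integrable hfi
      fun_prop)]
  refine lintegral_congr_ae ?_
  filter_upwards [compl_mem_ae_iff.2 (measure_singleton (0 : ℝ))] with t ht
  have ht : t ≠ 0 := ht
  rw [fourier_indicator_Ioc (abs_nonneg ξ) ht, ← ofReal_norm, ← ENNReal.ofReal_pow (norm_nonneg _),
    ← ENNReal.ofReal_mul (by positivity), norm_div, Complex.norm_exp_I_mul_ofReal_sub_one,
    norm_mul _ Complex.I, Complex.norm_I, mul_one, Complex.norm_real, div_pow, Real.norm_eq_abs,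
    sq_abs, Real.norm_eq_abs, sq_abs]
  congr 1
  have hs : (2 * Real.sin (-2 * Real.pi * t * |ξ| / 2)) ^ 2
      = (2 * Real.sin (Real.pi * t * ξ)) ^ 2 := by
    rcases abs_cases ξ with ⟨h, _⟩ | ⟨h, _⟩
    · rw [h, show -2 * Real.pi * t * ξ / 2 = -(Real.pi * t * ξ) by ring, Real.sin_neg]; ring
    · rw [h, show -2 * Real.pi * t * -ξ / 2 = Real.pi * t * ξ by ring]
  rw [hs]
  have := Real.pi_ne_zero
  field_simp
  ring

theorem setLIntegral_Ioi_sin_sq_div_sq (ξ : ℝ) :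
    ∫⁻ t in Ioi 0, ENNReal.ofReal ((2 * Real.sin (Real.pi * t * ξ)) ^ 2 / t ^ 2) =
      ENNReal.ofReal (2 * Real.pi ^ 2 * |ξ|) := by
  have h := lintegral_eq_two_mul_setLIntegral_Ioi
    (f := fun t => ENNReal.ofReal ((2 * Real.sin (Real.pi * t * ξ)) ^ 2 / t ^ 2))
    (by fun_prop) (fun t => by simp)
  rw [lintegral_sin_sq_div_sq, show 4 * Real.pi ^ 2 * |ξ| = 2 * (2 * Real.pi ^ 2 * |ξ|) by ring,
    ENNReal.ofReal_mul two_pos.le, ENNReal.ofReal_ofNat] at h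
  exact ((ENNReal.mul_right_inj (by simp) (by simp)).1 h).symm

/-- Plancherel's identity for the difference of a function and its translate. -/
theorem lintegral_sub_translate_sq {w : ℝ → ℝ} (hw : Integrable w) (hw2 : MemLp w 2) (t : ℝ) :
    ∫⁻ x, ENNReal.ofReal ((w (x + t) - w x) ^ 2) =
      ∫⁻ ξ, ENNReal.ofReal ((2 * Real.sin (Real.pi * t * ξ)) ^ 2) *
        ‖𝓕 (fun x => (w x : ℂ)) ξ‖ₑ ^ 2 := by
  have h1 : Integrable (fun x => (w x : ℂ)) := hw.ofReal
  have h1t : Integrable (fun x => (w (x + t) : ℂ)) := h1.comp_add_right t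
  have h2 : MemLp (fun x => (w x : ℂ)) 2 := hw2.ofReal
  have h2t : MemLp (fun x => (w (x + t) : ℂ)) 2 :=
    h2.comp_measurePreserving (measurePreserving_add_right volume t)
  have key := lintegral_enorm_fourier_sq (h1t.sub h1) (h2t.sub h2)
  calc _ = ∫⁻ x, ‖((fun x => (w (x + t) : ℂ)) - fun x => (w x : ℂ)) x‖ₑ ^ 2 := by
        refine lintegral_congr fun x => ?_
        rw [Pi.sub_apply, ← Complex.ofReal_sub, ← ofReal_norm, Complex.norm_real,
          ← ENNReal.ofReal_pow (norm_nonneg _), Real.norm_eq_abs, sq_abs]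
    _ = _ := by
        rw [← key]
        refine lintegral_congr fun ξ => ?_
        have e : 𝓕 ((fun x => (w (x + t) : ℂ)) - fun x => (w x : ℂ)) ξ =
            (Complex.exp (Complex.I * ((2 * Real.pi * t * ξ : ℝ) : ℂ)) - 1) *
              𝓕 (fun x => (w x : ℂ)) ξ := by
          have e2 : 𝓕 (fun x => (w (x + t) : ℂ)) ξ =
              Complex.exp (Complex.I * ((2 * Real.pi * t * ξ : ℝ) : ℂ)) *
                𝓕 (fun x => (w x : ℂ)) ξ := by
            have := congrFun (VectorFourier.fourierIntegral_comp_add_right Real.fourierChar volume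
              (innerₗ ℝ) (fun x => (w x : ℂ)) t) ξ
            refine this.trans ?_
            simp only [Circle.smul_def, Real.fourierChar_apply, smul_eq_mul]
            congr 2
            simp
            ring
          rw [sub_mul, one_mul, ← e2]
          simp only [Real.fourier_eq, Pi.sub_apply, smul_sub]
          exact integral_sub ((Real.fourierIntegral_convergent_iff ξ).2 h1t)
            ((Real.fourierIntegral_convergent_iff ξ).2 h1)
        rw [e, enorm_mul, mul_pow, ← ofReal_norm, Complex.norm_exp_I_mul_ofReal_sub_one,
          ← ENNReal.ofReal_pow (norm_nonneg _), Real.norm_eq_abs, sq_abs,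
          show 2 * Real.pi * t * ξ / 2 = Real.pi * t * ξ by ring]

end SineKernel

section DifferenceQuotient

variable {w : ℝ → ℝ}

/-- The Dirichlet form of `w` as a weighted integral of its difference quotients. -/
theorem lintegral_sub_translate_sq_div (hw : Integrable w) (hw2 : MemLp w 2) :
    ∫⁻ t in Ioi 0, (∫⁻ x, ENNReal.ofReal ((w (x + t) - w x) ^ 2)) / ENNReal.ofReal (t ^ 2) =
      ENNReal.ofReal (2 * Real.pi ^ 2) *
        ∫⁻ ξ, ENNReal.ofReal |ξ| * ‖𝓕 (fun x => (w x : ℂ)) ξ‖ₑ ^ 2 := by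
  have hc : Continuous (𝓕 fun x => (w x : ℂ)) := continuous_fourier_of_integrable hw.ofReal
  have hm := hc.measurable
  calc _ = ∫⁻ t in Ioi 0, ∫⁻ ξ, ENNReal.ofReal ((2 * Real.sin (Real.pi * t * ξ)) ^ 2 / t ^ 2) *
            ‖𝓕 (fun x => (w x : ℂ)) ξ‖ₑ ^ 2 := by
        refine setLIntegral_congr_fun measurableSet_Ioi fun t ht => ?_
        have ht : 0 < t := ht
        rw [lintegral_sub_translate_sq hw hw2, div_eq_mul_inv, ← lintegral_mul_const' _ _ (by
          simp [ht.ne'])]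
        refine lintegral_congr fun ξ => ?_
        rw [ENNReal.ofReal_div_of_pos (by positivity), div_eq_mul_inv]
        ring
    _ = ∫⁻ ξ, ∫⁻ t in Ioi 0, ENNReal.ofReal ((2 * Real.sin (Real.pi * t * ξ)) ^ 2 / t ^ 2) *
            ‖𝓕 (fun x => (w x : ℂ)) ξ‖ₑ ^ 2 := lintegral_lintegral_swap (by fun_prop)
    _ = ∫⁻ ξ, ENNReal.ofReal (2 * Real.pi ^ 2) *
            (ENNReal.ofReal |ξ| * ‖𝓕 (fun x => (w x : ℂ)) ξ‖ₑ ^ 2) := by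
        refine lintegral_congr fun ξ => ?_
        rw [lintegral_mul_const _ (by fun_prop), setLIntegral_Ioi_sin_sq_div_sq,
          ENNReal.ofReal_mul (by positivity), mul_assoc]
    _ = _ := lintegral_const_mul _ (by fun_prop)

theorem tendsto_sin_sq_div_sq (ξ : ℝ) :
    Tendsto (fun t : ℝ => (2 * Real.sin (Real.pi * t * ξ)) ^ 2 / t ^ 2) (𝓝[≠] 0)
      (𝓝 ((2 * Real.pi * ξ) ^ 2)) := by
  have h : HasDerivAt (fun t : ℝ => 2 * Real.sin (Real.pi * t * ξ)) (2 * Real.pi * ξ) 0 := by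
    have h1 : HasDerivAt (fun t : ℝ => Real.pi * t * ξ) (Real.pi * ξ) 0 := by
      simpa using ((hasDerivAt_id (0 : ℝ)).const_mul Real.pi).mul_const ξ
    convert! (h1.sin).const_mul 2 using 1
    simp; ring
  have h2 := (hasDerivAt_iff_tendsto_slope_zero.1 h).pow 2
  refine h2.congr fun t => ?_
  simp [div_eq_inv_mul, mul_pow]

/-- An `L²` bound on difference quotients bounds the derivative on the Fourier side. -/
theorem lintegral_sq_mul_fourier_le (hw : Integrable w) (hw2 : MemLp w 2) {C : ℝ≥0∞}
    (hC : ∀ t, 0 < t →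
      ∫⁻ x, ENNReal.ofReal ((w (x + t) - w x) ^ 2) ≤ ENNReal.ofReal (t ^ 2) * C) :
    ∫⁻ ξ, ENNReal.ofReal ((2 * Real.pi * ξ) ^ 2) * ‖𝓕 (fun x => (w x : ℂ)) ξ‖ₑ ^ 2 ≤ C := by
  have hc : Continuous (𝓕 fun x => (w x : ℂ)) := continuous_fourier_of_integrable hw.ofReal
  have hm := hc.measurable
  set τ : ℕ → ℝ := fun n => 1 / ((n : ℝ) + 1)
  have hτ0 : ∀ n, 0 < τ n := fun n => by positivity
  have hτ : Tendsto τ atTop (𝓝[≠] 0) :=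
    tendsto_nhdsWithin_iff.2 ⟨tendsto_one_div_add_atTop_nhds_zero_nat,
      Eventually.of_forall fun n => (hτ0 n).ne'⟩
  set f : ℕ → ℝ → ℝ≥0∞ := fun n ξ =>
    ENNReal.ofReal ((2 * Real.sin (Real.pi * τ n * ξ)) ^ 2 / (τ n) ^ 2) *
      ‖𝓕 (fun x => (w x : ℂ)) ξ‖ₑ ^ 2
  have hlim : ∀ ξ, Tendsto (fun n => f n ξ) atTop
      (𝓝 (ENNReal.ofReal ((2 * Real.pi * ξ) ^ 2) * ‖𝓕 (fun x => (w x : ℂ)) ξ‖ₑ ^ 2)) := fun ξ =>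
    ENNReal.Tendsto.mul_const (ENNReal.tendsto_ofReal ((tendsto_sin_sq_div_sq ξ).comp hτ))
      (Or.inr (by simp))
  have hf : ∀ n, ∫⁻ ξ, f n ξ ≤ C := fun n => by
    have ht := hτ0 n
    have h := hC _ ht
    rw [lintegral_sub_translate_sq hw hw2] at h
    have e : ∫⁻ ξ, f n ξ = (ENNReal.ofReal (τ n ^ 2))⁻¹ *
        ∫⁻ ξ, ENNReal.ofReal ((2 * Real.sin (Real.pi * τ n * ξ)) ^ 2) *
          ‖𝓕 (fun x => (w x : ℂ)) ξ‖ₑ ^ 2 := by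
      rw [← lintegral_const_mul _ (by fun_prop)]
      refine lintegral_congr fun ξ => ?_
      simp only [f]
      rw [ENNReal.ofReal_div_of_pos (by positivity), div_eq_mul_inv]
      ring
    rw [e]
    refine (mul_le_mul_right h _).trans ?_
    rw [← mul_assoc, ENNReal.inv_mul_cancel (by simpa using ht.ne') ENNReal.ofReal_ne_top, one_mul]
  calc _ = ∫⁻ ξ, liminf (fun n => f n ξ) atTop :=
        lintegral_congr fun ξ => (hlim ξ).liminf_eq.symm
    _ ≤ liminf (fun n => ∫⁻ ξ, f n ξ) atTop := lintegral_liminf_le fun n => by fun_prop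
    _ ≤ C := liminf_le_of_le (by isBoundedDefault) fun b hb =>
        let ⟨n, hn⟩ := hb.exists; hn.trans (hf n)

theorem integrable_fourier_of_sub_translate_le (hw : Integrable w) (hw2 : MemLp w 2) {C : ℝ≥0∞}
    (hCtop : C ≠ ⊤) (hC : ∀ t, 0 < t →
      ∫⁻ x, ENNReal.ofReal ((w (x + t) - w x) ^ 2) ≤ ENNReal.ofReal (t ^ 2) * C) :
    Integrable (𝓕 fun x => (w x : ℂ)) := by
  have hc : Continuous (𝓕 fun x => (w x : ℂ)) := continuous_fourier_of_integrable hw.ofReal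
  have hsq : Integrable (fun ξ => ‖𝓕 (fun x => (w x : ℂ)) ξ‖ ^ 2) :=
    (memLp_fourier hw.ofReal hw2.ofReal).integrable_norm_pow (by norm_num)
  have hder : Integrable (fun ξ => (2 * Real.pi * ξ) ^ 2 * ‖𝓕 (fun x => (w x : ℂ)) ξ‖ ^ 2) := by
    refine ⟨by fun_prop, ?_⟩
    refine lt_of_eq_of_lt (lintegral_congr fun ξ => ?_)
      ((lintegral_sq_mul_fourier_le hw hw2 hC).trans_lt hCtop.lt_top)
    rw [enorm_mul, enorm_pow ‖_‖, enorm_norm, Real.enorm_of_nonneg (sq_nonneg _)]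
  refine ((integrable_inv_one_add_sq.add hsq).add hder).mono' hc.aestronglyMeasurable
    (ae_of_all _ fun ξ => ?_)
  simp only [Pi.add_apply]
  set a := ‖𝓕 (fun x => (w x : ℂ)) ξ‖
  have hpi : 1 ≤ (2 * Real.pi) ^ 2 := by nlinarith [Real.pi_gt_three]
  have hp : 0 < 1 + ξ ^ 2 := by positivity
  have h1 : ξ ^ 2 * a ^ 2 ≤ (2 * Real.pi * ξ) ^ 2 * a ^ 2 := by
    rw [mul_pow]; gcongr; nlinarith [sq_nonneg ξ]
  have h2 : 2 * a ≤ (1 + ξ ^ 2)⁻¹ + (1 + ξ ^ 2) * a ^ 2 := by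
    have h3 : (1 + ξ ^ 2)⁻¹ * ((1 + ξ ^ 2) * a - 1) ^ 2
        = (1 + ξ ^ 2)⁻¹ + (1 + ξ ^ 2) * a ^ 2 - 2 * a := by
      field_simp; ring
    have h4 : 0 ≤ (1 + ξ ^ 2)⁻¹ * ((1 + ξ ^ 2) * a - 1) ^ 2 := by positivity
    linarith
  have ha : 0 ≤ a := norm_nonneg _
  linarith

/-- The sharp Gagliardo–Nirenberg inequality for `∫ w³`, in terms of difference quotients. -/
theorem integral_pow_three_le_of_sub_translate_le (hwc : Continuous w) (hw : Integrable w)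
    (hw2 : MemLp w 2) {C : ℝ≥0∞} (hCtop : C ≠ ⊤) (hC : ∀ t, 0 < t →
      ∫⁻ x, ENNReal.ofReal ((w (x + t) - w x) ^ 2) ≤ ENNReal.ofReal (t ^ 2) * C) {D : ℝ}
    (hD0 : 0 ≤ D)
    (hD : ∫⁻ t in Ioi 0, (∫⁻ x, ENNReal.ofReal ((w (x + t) - w x) ^ 2)) / ENNReal.ofReal (t ^ 2)
      ≤ ENNReal.ofReal (Real.pi * D)) :
    ∫ x, w x ^ 3 ≤ 3 / (2 * √Real.pi) * √D * ∫ x, w x ^ 2 := by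
  have hpi := Real.pi_pos
  have hW := integrable_fourier_of_sub_translate_le hw hw2 hCtop hC
  rw [lintegral_sub_translate_sq_div hw hw2] at hD
  set N := ∫⁻ ξ, ENNReal.ofReal |ξ| * ‖𝓕 (fun x => (w x : ℂ)) ξ‖ₑ ^ 2 with hN
  have hNtop : N ≠ ⊤ := fun h => by
    rw [h, ENNReal.mul_top (by simp [hpi.ne'])] at hD
    exact absurd hD (by simp)
  have hND : N.toReal / 2 ≤ D / (4 * Real.pi) := by
    rw [← ENNReal.ofReal_toReal hNtop, ← ENNReal.ofReal_mul (by positivity),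
      ENNReal.ofReal_le_ofReal_iff (by positivity)] at hD
    rw [le_div_iff₀ (by positivity)]
    nlinarith
  refine (integral_pow_three_le hwc hw hw2 hW hNtop).trans ?_
  refine mul_le_mul_of_nonneg_right ?_ (integral_nonneg fun x => sq_nonneg _)
  calc 3 * √(N.toReal / 2) ≤ 3 * √(D / (4 * Real.pi)) := by gcongr
    _ = 3 / (2 * √Real.pi) * √D := by
      rw [Real.sqrt_div hD0, Real.sqrt_mul (by norm_num),
        show √4 = 2 by rw [show (4 : ℝ) = 2 ^ 2 by norm_num, Real.sqrt_sq two_pos.le]]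
      ring

end DifferenceQuotient

section PrincipalValue

variable {f : ℝ → ℝ} {L : ℝ}

theorem abs_foldedKernel_le (hL : ∀ a b, |f a - f b| ≤ L * |a - b|) (x : ℝ) {t : ℝ}
    (ht : 0 < t) :
    |(f (x - t) - f (x + t)) / t| ≤
      (Ioc (0 : ℝ) 1).indicator (fun _ => 2 * L) t + (|f (x - t)| + |f (x + t)|) := by
  rw [abs_div, abs_of_pos ht, div_le_iff₀ ht]
  have h0 : 0 ≤ |f (x - t)| + |f (x + t)| := by positivity
  rcases le_or_gt t 1 with h1 | h1
  · rw [indicator_of_mem (show t ∈ Ioc (0 : ℝ) 1 from ⟨ht, h1⟩)]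
    refine (hL _ _).trans ?_
    rw [show x - t - (x + t) = -(2 * t) by ring, abs_neg, abs_of_pos (by positivity)]
    nlinarith
  · rw [indicator_of_notMem (by simp [h1])]
    have := abs_sub (f (x - t)) (f (x + t))
    nlinarith

theorem integrableOn_foldedBound (hf : Integrable f) (x : ℝ) :
    IntegrableOn (fun t => (Ioc (0 : ℝ) 1).indicator (fun _ => 2 * L) t +
      (|f (x - t)| + |f (x + t)|)) (Ioi 0) := by
  refine Integrable.integrableOn (Integrable.add ?_ ((hf.comp_sub_left x).abs.add
    (hf.comp_add_left x).abs))
  exact (integrable_indicator_iff measurableSet_Ioc).2 (integrableOn_const (by simp))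

theorem integrableOn_foldedKernel (hfc : Continuous f) (hf : Integrable f)
    (hL : ∀ a b, |f a - f b| ≤ L * |a - b|) (x : ℝ) :
    IntegrableOn (fun t => (f (x - t) - f (x + t)) / t) (Ioi 0) := by
  have hm := hfc.measurable
  refine (integrableOn_foldedBound (L := L) hf x).mono' (Measurable.aestronglyMeasurable (by fun_prop)) ?_
  filter_upwards [ae_restrict_mem measurableSet_Ioi] with t ht
  exact abs_foldedKernel_le hL x ht

theorem integral_abs_foldedKernel_le (hfc : Continuous f) (hf : Integrable f) (hL0 : 0 ≤ L)
    (hL : ∀ a b, |f a - f b| ≤ L * |a - b|) (x : ℝ) :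
    ∫ t in Ioi 0, |(f (x - t) - f (x + t)) / t| ≤ 2 * L + 2 * ∫ y, |f y| := by
  have hi : Integrable (fun t => (Ioc (0 : ℝ) 1).indicator (fun _ => 2 * L) t) :=
    (integrable_indicator_iff measurableSet_Ioc).2 (integrableOn_const (by simp))
  have h1 := (hf.comp_sub_left x).abs
  have h2 := (hf.comp_add_left x).abs
  have h12 : Integrable (fun t => |f (x - t)| + |f (x + t)|) := h1.add h2
  calc _ ≤ ∫ t in Ioi 0, ((Ioc (0 : ℝ) 1).indicator (fun _ => 2 * L) t +
        (|f (x - t)| + |f (x + t)|)) :=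
        setIntegral_mono_on (integrableOn_foldedKernel hfc hf hL x).abs
          (integrableOn_foldedBound hf x) measurableSet_Ioi
          fun t ht => abs_foldedKernel_le hL x ht
    _ ≤ ∫ t, ((Ioc (0 : ℝ) 1).indicator (fun _ => 2 * L) t + (|f (x - t)| + |f (x + t)|)) :=
        setIntegral_le_integral (hi.add h12) (ae_of_all _ fun t =>
          add_nonneg (indicator_nonneg (fun _ _ => by positivity) _) (by positivity))
    _ = _ := by
        rw [integral_add hi h12, integral_add h1 h2, integral_indicator measurableSet_Ioc,
          integral_sub_left_eq_self (fun y => |f y|), integral_add_left_eq_self (fun y => |f y|)]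
        simp
        ring

theorem setIntegral_hilbertKernel_eq (hf : Integrable f) (x : ℝ) {ε : ℝ} (hε : 0 < ε) :
    ∫ y in {y : ℝ | ε < |x - y|}, f y / (x - y) =
      ∫ t in Ioi ε, (f (x - t) - f (x + t)) / t := by
  have hset : {t : ℝ | ε < |t|} = Iio (-ε) ∪ Ioi ε := by
    ext t
    simp only [mem_ofPred_eq, lt_abs, mem_union, mem_Iio, mem_Ioi]
    constructor <;> rintro (h | h)
    · exact Or.inr h
    · exact Or.inl (by linarith)
    · exact Or.inr (by linarith)
    · exact Or.inl h
  have hms : MeasurableSet {t : ℝ | ε < |t|} := measurableSet_lt (by fun_prop) (by fun_prop)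
  have hms' : MeasurableSet {y : ℝ | ε < |x - y|} := measurableSet_lt (by fun_prop) (by fun_prop)
  have hbd : ∀ g : ℝ → ℝ, Integrable g → IntegrableOn (fun t => g t / t) {t : ℝ | ε < |t|} := by
    intro g hg
    refine (hg.norm.div_const ε).integrableOn.mono'
      (hg.aestronglyMeasurable.restrict.div₀ (by fun_prop)) ?_
    filter_upwards [ae_restrict_mem hms] with t ht
    have ht : ε < |t| := ht
    rw [norm_div, Real.norm_eq_abs t]
    gcongr
  have h1 := hbd _ (hf.comp_sub_left x)
  have h2 := hbd _ (hf.comp_add_left x)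
  have hsub : Ioi ε ⊆ {t : ℝ | ε < |t|} := hset ▸ subset_union_right
  have hsub' : Iio (-ε) ⊆ {t : ℝ | ε < |t|} := hset ▸ subset_union_left
  calc _ = ∫ t in {t : ℝ | ε < |t|}, f (x - t) / t := by
        rw [← integral_indicator hms', ← integral_indicator hms,
          ← integral_sub_left_eq_self _ volume x]
        congr 1 with t
        by_cases h : ε < |t| <;> simp [indicator, h]
    _ = (∫ t in Iio (-ε), f (x - t) / t) + ∫ t in Ioi ε, f (x - t) / t := by
        have hd : Disjoint (Iio (-ε)) (Ioi ε) := by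
          rw [Set.disjoint_left]; intro t ht ht'
          simp only [mem_Iio, mem_Ioi] at ht ht'; linarith
        rw [hset, setIntegral_union hd measurableSet_Ioi (h1.mono_set hsub') (h1.mono_set hsub)]
    _ = (∫ t in Ioi ε, -(f (x + t) / t)) + ∫ t in Ioi ε, f (x - t) / t := by
        rw [← integral_Iic_eq_integral_Iio, ← integral_comp_neg_Ioi]
        congr 2 with t
        rw [sub_neg_eq_add, div_neg]
    _ = _ := by
        have h3 : IntegrableOn (fun t => -(f (x + t) / t)) (Ioi ε) := (h2.mono_set hsub).neg
        rw [← integral_add h3 (h1.mono_set hsub)]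
        congr 1 with t
        ring

/-- The principal value integral in folded form. -/
theorem hilbertPVR_of_lipschitz (hfc : Continuous f) (hf : Integrable f)
    (hL : ∀ a b, |f a - f b| ≤ L * |a - b|) (x : ℝ) :
    HilbertPVR f x ((1 / Real.pi) * ∫ t in Ioi 0, (f (x - t) - f (x + t)) / t) := by
  refine Tendsto.const_mul _ ?_
  have hcov : AECover (volume.restrict (Ioi (0 : ℝ))) (𝓝[>] (0 : ℝ)) fun ε => Ioi ε :=
    aecover_Ioi_of_Ioi (tendsto_id.mono_left nhdsWithin_le_nhds)
  refine (hcov.integral_tendsto_of_countably_generated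
    (integrableOn_foldedKernel hfc hf hL x)).congr' ?_
  filter_upwards [self_mem_nhdsWithin] with ε hε
  rw [setIntegral_hilbertKernel_eq hf x hε, Measure.restrict_restrict measurableSet_Ioi,
    inter_eq_self_of_subset_left (Ioi_subset_Ioi (le_of_lt hε))]

/-- The pairing with the Hilbert transform is absolutely convergent as a double integral. -/
theorem integrable_mul_foldedKernel {g : ℝ → ℝ} (hgc : Continuous g) (hg : Integrable g)
    (hfc : Continuous f) (hf : Integrable f) (hL0 : 0 ≤ L)
    (hL : ∀ a b, |f a - f b| ≤ L * |a - b|) :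
    Integrable (fun p : ℝ × ℝ => g p.1 * ((f (p.1 - p.2) - f (p.1 + p.2)) / p.2))
      (volume.prod (volume.restrict (Ioi 0))) := by
  have hm := hfc.measurable
  have hgm := hgc.measurable
  have hmeas : Measurable
      (fun p : ℝ × ℝ => g p.1 * ((f (p.1 - p.2) - f (p.1 + p.2)) / p.2)) := by fun_prop
  refine (integrable_prod_iff hmeas.aestronglyMeasurable).2
    ⟨ae_of_all _ fun x => (integrableOn_foldedKernel hfc hf hL x).const_mul (g x), ?_⟩
  refine (hg.norm.mul_const (2 * L + 2 * ∫ y, |f y|)).mono'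
    hmeas.aestronglyMeasurable.norm.integral_prod_right' (ae_of_all _ fun x => ?_)
  simp only [norm_mul]
  rw [integral_const_mul, norm_mul, norm_norm]
  gcongr
  rw [Real.norm_of_nonneg (integral_nonneg fun t => norm_nonneg _)]
  exact integral_abs_foldedKernel_le hfc hf hL0 hL x

end PrincipalValue

section SquaredDifference

variable {g g' : ℝ → ℝ} {B L M : ℝ}

theorem integrable_mul_translate {f : ℝ → ℝ} (hg : Integrable g) (hf : Continuous f)
    (hM : ∀ x, |f x| ≤ M) (t : ℝ) : Integrable (fun x => g x * f (x + t)) :=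
  hg.mul_bdd (c := M) (by fun_prop) (ae_of_all _ fun x => hM (x + t))

theorem integral_sub_translate_sq_eq (hgc : Continuous g) (hg : Integrable g)
    (hB : ∀ x, |g x| ≤ B) (t : ℝ) :
    ∫ x, (g (x + t) - g x) ^ 2 = 2 * (∫ x, g x ^ 2) - 2 * ∫ x, g x * g (x + t) := by
  have hsq : Integrable fun x => g x ^ 2 := by
    simpa [sq] using integrable_mul_translate hg hgc hB 0
  have hsq' : Integrable fun x => g (x + t) ^ 2 := hsq.comp_add_right t
  have hmix := (integrable_mul_translate hg hgc hB t).const_mul 2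
  have hadd : Integrable fun x => g (x + t) ^ 2 + g x ^ 2 := hsq'.add hsq
  calc _ = ∫ x, (g (x + t) ^ 2 + g x ^ 2 - 2 * (g x * g (x + t))) := by
        congr 1 with x
        ring
    _ = _ := by
        rw [integral_sub hadd hmix, integral_add hsq' hsq, integral_const_mul,
          integral_add_right_eq_self (fun x => g x ^ 2)]
        ring

theorem hasDerivAt_integral_mul_translate (hd : ∀ x, HasDerivAt g (g' x) x) (hg : Integrable g)
    (hgc' : Continuous g') (hB : ∀ x, |g x| ≤ B) (hM : ∀ x, |g' x| ≤ M) (t : ℝ) :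
    HasDerivAt (fun t => ∫ x, g x * g (x + t)) (∫ x, g x * g' (x + t)) t := by
  have hgc : Continuous g := continuous_iff_continuousAt.2 fun x => (hd x).continuousAt
  refine (hasDerivAt_integral_of_dominated_loc_of_deriv_le (s := univ)
    (F := fun t x => g x * g (x + t)) (F' := fun t x => g x * g' (x + t))
    (bound := fun x => |g x| * M) univ_mem
    (Eventually.of_forall fun s => (integrable_mul_translate hg hgc hB s).aestronglyMeasurable)
    (integrable_mul_translate hg hgc hB t)
    (integrable_mul_translate hg hgc' hM t).aestronglyMeasurable
    (ae_of_all _ fun x s _ => ?_) (hg.abs.mul_const M) (ae_of_all _ fun x s _ => ?_)).2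
  · rw [norm_mul]
    exact mul_le_mul_of_nonneg_left (hM _) (abs_nonneg _)
  · exact ((hd (x + s)).comp_const_add x s).const_mul (g x)

theorem integral_mul_deriv_translate (hd : ∀ x, HasDerivAt g (g' x) x) (hg : Integrable g)
    (hgc' : Continuous g') (hB : ∀ x, |g x| ≤ B) (hM : ∀ x, |g' x| ≤ M)
    (hg' : Integrable g') (t : ℝ) :
    ∫ x, g x * g' (x - t) = -∫ x, g x * g' (x + t) := by
  have hgc : Continuous g := continuous_iff_continuousAt.2 fun x => (hd x).continuousAt
  have hcomm : (fun x => g' x * g (x + t)) = (fun x => g (x + t)) * g' :=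
    funext fun x => mul_comm _ _
  calc _ = ∫ x, g (x + t) * g' x := by
        rw [← integral_add_right_eq_self _ t]
        simp
    _ = -∫ x, g' (x + t) * g x :=
        integral_mul_deriv_eq_deriv_mul_of_integrable (u := fun x => g (x + t))
          (u' := fun x => g' (x + t)) (v := g) (v' := g')
          (fun x _ => (hd (x + t)).comp_add_const x t) (fun x _ => hd x)
          (hcomm ▸ integrable_mul_translate hg' hgc hB t)
          (by simpa [mul_comm, Pi.mul_def] using integrable_mul_translate hg hgc' hM t)
          (by simpa [mul_comm, Pi.mul_def] using integrable_mul_translate hg hgc hB t)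
    _ = _ := by simp_rw [mul_comm]

theorem hasDerivAt_integral_sub_translate_sq (hd : ∀ x, HasDerivAt g (g' x) x)
    (hg : Integrable g) (hgc' : Continuous g') (hB : ∀ x, |g x| ≤ B) (hM : ∀ x, |g' x| ≤ M)
    (hg' : Integrable g') (t : ℝ) :
    HasDerivAt (fun t => ∫ x, (g (x + t) - g x) ^ 2)
      (∫ x, g x * (g' (x - t) - g' (x + t))) t := by
  have hgc : Continuous g := continuous_iff_continuousAt.2 fun x => (hd x).continuousAt
  simp_rw [integral_sub_translate_sq_eq hgc hg hB, mul_sub]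
  rw [integral_sub (by simpa [sub_eq_add_neg] using integrable_mul_translate hg hgc' hM (-t))
    (integrable_mul_translate hg hgc' hM t), integral_mul_deriv_translate hd hg hgc' hB hM hg']
  rw [show -(∫ x, g x * g' (x + t)) - ∫ x, g x * g' (x + t) = -(2 * ∫ x, g x * g' (x + t)) by ring]
  exact ((hasDerivAt_integral_mul_translate hd hg hgc' hB hM t).const_mul 2).const_sub _

theorem integral_sub_translate_sq_le (hd : ∀ x, HasDerivAt g (g' x) x)
    (hg : Integrable g) (hgc' : Continuous g') (hB : ∀ x, |g x| ≤ B) (hM : ∀ x, |g' x| ≤ M)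
    (hg' : Integrable g') (hL0 : 0 ≤ L) (hL : ∀ a b, |g' a - g' b| ≤ L * |a - b|) {t : ℝ}
    (ht : 0 ≤ t) :
    ∫ x, (g (x + t) - g x) ^ 2 ≤ 2 * L * (∫ x, |g x|) * t ^ 2 := by
  have hK : 0 ≤ ∫ x, |g x| := integral_nonneg fun x => abs_nonneg _
  have hbd : ∀ s ∈ Icc 0 t, ‖∫ x, g x * (g' (x - s) - g' (x + s))‖ ≤
      2 * L * (∫ x, |g x|) * t := by
    intro s hs
    refine (norm_integral_le_of_norm_le (hg.abs.mul_const (L * (2 * s)))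
      (ae_of_all _ fun x => ?_)).trans ?_
    · rw [norm_mul]
      refine mul_le_mul_of_nonneg_left ((hL _ _).trans_eq ?_) (abs_nonneg _)
      rw [show x - s - (x + s) = -(2 * s) by ring, abs_neg, abs_of_nonneg (by linarith [hs.1])]
    · rw [integral_mul_const]
      nlinarith [mul_nonneg (mul_nonneg hL0 hK) (sub_nonneg.2 hs.2)]
  have := Convex.norm_image_sub_le_of_norm_hasDerivWithin_le
    (fun s _ => (hasDerivAt_integral_sub_translate_sq hd hg hgc' hB hM hg' s).hasDerivWithinAt)
    hbd (convex_Icc 0 t) (left_mem_Icc.2 ht) (right_mem_Icc.2 ht)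
  simp only [add_zero, sub_self, sub_zero, Real.norm_eq_abs, abs_of_nonneg ht] at this
  have h := (le_abs_self _).trans this
  simp only [ne_eq, OfNat.ofNat_ne_zero, not_false_eq_true, zero_pow, integral_zero, sub_zero] at h
  linarith

theorem integral_sub_translate_sq_le_four_mul (hgc : Continuous g) (hg : Integrable g)
    (hB : ∀ x, |g x| ≤ B) (t : ℝ) :
    ∫ x, (g (x + t) - g x) ^ 2 ≤ 4 * ∫ x, g x ^ 2 := by
  have hsq : Integrable fun x => g x ^ 2 := by
    simpa [sq] using integrable_mul_translate hg hgc hB 0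
  have hsq' : Integrable fun x => g (x + t) ^ 2 := hsq.comp_add_right t
  calc _ ≤ ∫ x, (2 * g (x + t) ^ 2 + 2 * g x ^ 2) :=
        integral_mono_of_nonneg (ae_of_all _ fun x => sq_nonneg _)
          ((hsq'.const_mul 2).add (hsq.const_mul 2))
          (ae_of_all _ fun x => by nlinarith [sq_nonneg (g (x + t) + g x)])
    _ = _ := by
        rw [integral_add (hsq'.const_mul 2) (hsq.const_mul 2), integral_const_mul,
          integral_const_mul, integral_add_right_eq_self (fun x => g x ^ 2)]
        ring

theorem integrableOn_integral_sub_translate_sq_div (hd : ∀ x, HasDerivAt g (g' x) x)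
    (hg : Integrable g) (hgc' : Continuous g') (hB : ∀ x, |g x| ≤ B) (hM : ∀ x, |g' x| ≤ M)
    (hg' : Integrable g') (hL0 : 0 ≤ L) (hL : ∀ a b, |g' a - g' b| ≤ L * |a - b|) :
    IntegrableOn (fun t => (∫ x, (g (x + t) - g x) ^ 2) / t ^ 2) (Ioi 0) := by
  have hgc : Continuous g := continuous_iff_continuousAt.2 fun x => (hd x).continuousAt
  have hS : Continuous fun t => ∫ x, (g (x + t) - g x) ^ 2 := continuous_iff_continuousAt.2
    fun t => (hasDerivAt_integral_sub_translate_sq hd hg hgc' hB hM hg' t).continuousAt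
  have hK : 0 ≤ 2 * L * ∫ x, |g x| :=
    mul_nonneg (by positivity) (integral_nonneg fun x => abs_nonneg _)
  have hK' : 0 ≤ ∫ x, g x ^ 2 := integral_nonneg fun x => sq_nonneg _
  refine (integrable_inv_one_add_sq.const_mul
    (2 * (2 * L * (∫ x, |g x|) + 4 * ∫ x, g x ^ 2))).integrableOn.mono'
    (hS.measurable.div (by fun_prop)).aestronglyMeasurable ?_
  filter_upwards [ae_restrict_mem measurableSet_Ioi] with t ht
  have ht : 0 < t := ht
  have h0 : 0 ≤ ∫ x, (g (x + t) - g x) ^ 2 := integral_nonneg fun x => sq_nonneg _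
  rw [Real.norm_of_nonneg (by positivity), ← div_eq_mul_inv,
    div_le_div_iff₀ (by positivity) (by positivity)]
  have h1 := integral_sub_translate_sq_le hd hg hgc' hB hM hg' hL0 hL ht.le
  have h2 := integral_sub_translate_sq_le_four_mul hgc hg hB t
  nlinarith [mul_le_mul_of_nonneg_right h2 (sq_nonneg t), mul_nonneg hK (sq_nonneg t)]

/-- The Dirichlet form `∫ g · H(g')`, up to the factor `π`, through difference quotients. -/
theorem integral_mul_foldedKernel_eq (hd : ∀ x, HasDerivAt g (g' x) x)
    (hg : Integrable g) (hgc' : Continuous g') (hB : ∀ x, |g x| ≤ B) (hM : ∀ x, |g' x| ≤ M)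
    (hg' : Integrable g') (hL0 : 0 ≤ L) (hL : ∀ a b, |g' a - g' b| ≤ L * |a - b|) :
    ∫ x, g x * ∫ t in Ioi 0, (g' (x - t) - g' (x + t)) / t =
      ∫ t in Ioi 0, (∫ x, (g (x + t) - g x) ^ 2) / t ^ 2 := by
  have hgc : Continuous g := continuous_iff_continuousAt.2 fun x => (hd x).continuousAt
  have hF := integrable_mul_foldedKernel hgc hg hgc' hg' hL0 hL
  have hpull : ∀ t, ∫ x, g x * ((g' (x - t) - g' (x + t)) / t) =
      (∫ x, g x * (g' (x - t) - g' (x + t))) / t := fun t => by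
    rw [← integral_div]
    simp_rw [mul_div_assoc]
  have hI := hF.integral_prod_right
  simp only [hpull] at hI
  have hI2 := integrableOn_integral_sub_translate_sq_div hd hg hgc' hB hM hg' hL0 hL
  have hI12 : Integrable (fun t => (∫ x, g x * (g' (x - t) - g' (x + t))) / t -
      (∫ x, (g (x + t) - g x) ^ 2) / t ^ 2) (volume.restrict (Ioi 0)) := hI.sub hI2
  have hSnn : ∀ t, 0 ≤ ∫ x, (g (x + t) - g x) ^ 2 := fun t => integral_nonneg fun x => sq_nonneg _
  calc _ = ∫ x, ∫ t in Ioi 0, g x * ((g' (x - t) - g' (x + t)) / t) := by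
        simp_rw [integral_const_mul]
    _ = ∫ t in Ioi 0, (∫ x, g x * (g' (x - t) - g' (x + t))) / t := by
        rw [integral_integral_swap hF]
        simp_rw [hpull]
    _ = _ := by
        rw [← sub_eq_zero, ← integral_sub hI hI2]
        rw [integral_Ioi_of_hasDerivAt_of_tendsto
          (f := fun t => (∫ x, (g (x + t) - g x) ^ 2) / t) (m := 0) ?_ ?_ hI12 ?_]
        · simp
        · have hlim : Tendsto (fun t : ℝ => 2 * L * (∫ x, |g x|) * t) (𝓝[Ici 0] 0) (𝓝 0) := by
            have : Continuous fun t : ℝ => 2 * L * (∫ x, |g x|) * t := by fun_prop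
            simpa using (this.tendsto 0).mono_left nhdsWithin_le_nhds
          have h0 : (∫ x, (g (x + 0) - g x) ^ 2) / (0 : ℝ) = 0 := div_zero _
          rw [ContinuousWithinAt, h0]
          refine squeeze_zero' ?_ ?_ hlim <;>
            filter_upwards [self_mem_nhdsWithin] with t ht
          · exact div_nonneg (hSnn t) ht
          · rcases (show 0 ≤ t from ht).eq_or_lt with rfl | htpos
            · simp
            · rw [div_le_iff₀ htpos, mul_assoc _ t t, ← sq]
              exact integral_sub_translate_sq_le hd hg hgc' hB hM hg' hL0 hL ht
        · intro t ht
          have ht : t ≠ 0 := (show 0 < t from ht).ne'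
          refine ((hasDerivAt_integral_sub_translate_sq hd hg hgc' hB hM hg' t).fun_div
            (hasDerivAt_id t) ht).congr_deriv ?_
          simp only [id]
          field_simp
        · have hlim : Tendsto (fun t : ℝ => (4 * ∫ x, g x ^ 2) / t) atTop (𝓝 0) :=
            tendsto_const_nhds.div_atTop tendsto_id
          refine squeeze_zero' ?_ ?_ hlim <;> filter_upwards [eventually_gt_atTop 0] with t ht
          · exact div_nonneg (hSnn t) ht.le
          · have := integral_sub_translate_sq_le_four_mul hgc hg hB t
            gcongr

end SquaredDifference

theorem SchwartzMap.abs_deriv_sub_le (v : 𝓢(ℝ, ℝ)) (a b : ℝ) :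
    |deriv v a - deriv v b| ≤
      SchwartzMap.seminorm ℝ 0 0 (derivCLM ℝ ℝ (derivCLM ℝ ℝ v)) * |a - b| := by
  have hd : ⇑(derivCLM ℝ ℝ v) = deriv v := funext fun x => derivCLM_apply ℝ v x
  refine Convex.norm_image_sub_le_of_norm_deriv_le (s := univ) (f := deriv v)
    (fun x _ => ?_) (fun x _ => ?_) convex_univ (mem_univ b) (mem_univ a)
  · rw [← hd]
    exact ((derivCLM ℝ ℝ v).hasDerivAt x).differentiableAt
  · rw [← hd, ← derivCLM_apply ℝ (derivCLM ℝ ℝ v) x]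
    exact norm_le_seminorm ℝ _ x

theorem integral_four_div_one_add_sq_sq :
    ∫ x : ℝ, (4 / (1 + x ^ 2)) ^ 2 = 8 * Real.pi := by
  have hpos : ∀ x : ℝ, 0 < 1 + x ^ 2 := fun x => by positivity
  have hle : ∀ x : ℝ, (4 / (1 + x ^ 2)) ^ 2 ≤ 16 * (1 + x ^ 2)⁻¹ := fun x => by
    rw [div_pow, ← div_eq_mul_inv, div_le_div_iff₀ (pow_pos (hpos x) 2) (hpos x)]
    nlinarith [sq_nonneg x, sq_nonneg (x ^ 2)]
  have hlim : Tendsto (fun x : ℝ => 8 * (x / (1 + x ^ 2))) (cocompact ℝ) (𝓝 0) := by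
    have hinv : Tendsto (fun x : ℝ => 8 * ‖x‖⁻¹) (cocompact ℝ) (𝓝 0) := by
      simpa using (tendsto_inv_atTop_zero.comp (tendsto_norm_cocompact_atTop (E := ℝ))).const_mul 8
    refine squeeze_zero_norm (fun x => ?_) hinv
    rw [norm_mul, norm_div, Real.norm_of_nonneg (by norm_num : (0 : ℝ) ≤ 8),
      Real.norm_of_nonneg (hpos x).le]
    gcongr
    rcases eq_or_ne x 0 with rfl | hx
    · simp
    · have hx' : 0 < ‖x‖ := norm_pos_iff.2 hx
      rw [div_le_iff₀ (hpos x), inv_mul_eq_div, le_div_iff₀ hx', Real.norm_eq_abs,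
        abs_mul_abs_self]
      linarith [sq x]
  rw [integral_of_hasDerivAt_of_tendsto
    (f := fun x => 8 * (x / (1 + x ^ 2)) + 8 * Real.arctan x) (m := 0 + 8 * -(Real.pi / 2))
    (n := 0 + 8 * (Real.pi / 2)) (fun x => ?_) ?_ ?_ ?_]
  · ring
  · have hc : Continuous fun x : ℝ => (4 / (1 + x ^ 2)) ^ 2 :=
      (continuous_const.div (by fun_prop) fun x => (hpos x).ne').pow 2
    refine (integrable_inv_one_add_sq.const_mul 16).mono' hc.aestronglyMeasurable
      (ae_of_all _ fun x => ?_)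
    rw [Real.norm_of_nonneg (by positivity)]
    exact hle x
  · exact (hlim.mono_left atBot_le_cocompact).add
      ((Real.tendsto_arctan_atBot.mono_right nhdsWithin_le_nhds).const_mul 8)
  · exact (hlim.mono_left atTop_le_cocompact).add
      ((Real.tendsto_arctan_atTop.mono_right nhdsWithin_le_nhds).const_mul 8)
  · refine HasDerivAt.congr_deriv (f' := 8 * ((1 * (1 + x ^ 2) - x * (2 * x)) / (1 + x ^ 2) ^ 2) +
      8 * (1 / (1 + x ^ 2))) ?_ ?_
    · have hq : HasDerivAt (fun x : ℝ => 1 + x ^ 2) (2 * x) x := by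
        simpa using (hasDerivAt_pow 2 x).const_add 1
      exact (((hasDerivAt_id x).fun_div hq (hpos x).ne').const_mul 8).add
        ((Real.hasDerivAt_arctan x).const_mul 8)
    · have := (hpos x).ne'
      field_simp
      ring

theorem three_div_two_mul_sqrt_pi :
    3 / (2 * √Real.pi) = (2 * 3 / 2) * √(2 / ((2 - 1) * (8 * Real.pi))) := by
  have h : 2 / ((2 - 1) * (8 * Real.pi)) = (1 / (2 * √Real.pi)) ^ 2 := by
    rw [div_pow, mul_pow, Real.sq_sqrt Real.pi_pos.le]
    field_simp
    norm_num
  rw [h, Real.sqrt_sq (by positivity)]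
  ring

theorem integral_abs_pow_three_le {g g' : ℝ → ℝ} {B L M : ℝ} (hd : ∀ x, HasDerivAt g (g' x) x)
    (hg : Integrable g) (hgc' : Continuous g') (hB : ∀ x, |g x| ≤ B) (hM : ∀ x, |g' x| ≤ M)
    (hg' : Integrable g') (hL0 : 0 ≤ L) (hL : ∀ a b, |g' a - g' b| ≤ L * |a - b|) :
    ∫ x, |g x| ^ 3 ≤ 3 / (2 * √Real.pi) *
      √((1 / Real.pi) * ∫ t in Ioi 0, (∫ x, (g (x + t) - g x) ^ 2) / t ^ 2) *
      ∫ x, g x ^ 2 := by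
  have hgc : Continuous g := continuous_iff_continuousAt.2 fun x => (hd x).continuousAt
  have hsq : Integrable fun x => g x ^ 2 := by
    simpa [sq] using integrable_mul_translate hg hgc hB 0
  have hsqt : ∀ t, Integrable fun x => (g (x + t) - g x) ^ 2 := fun t => by
    refine (((hsq.comp_add_right t).add hsq).const_mul 2).mono'
      (by fun_prop : Continuous fun x => (g (x + t) - g x) ^ 2).aestronglyMeasurable
      (ae_of_all _ fun x => ?_)
    rw [Real.norm_of_nonneg (sq_nonneg _)]
    simp only [Pi.add_apply]
    nlinarith [sq_nonneg (g (x + t) + g x)]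
  have hSnn : ∀ t, 0 ≤ ∫ x, (g (x + t) - g x) ^ 2 := fun t => integral_nonneg fun x => sq_nonneg _
  have habs : ∀ t, ∫⁻ x, ENNReal.ofReal ((|g (x + t)| - |g x|) ^ 2) ≤
      ENNReal.ofReal (∫ x, (g (x + t) - g x) ^ 2) := fun t => by
    rw [ofReal_integral_eq_lintegral_ofReal (hsqt t) (ae_of_all _ fun x => sq_nonneg _)]
    exact lintegral_mono fun x => ENNReal.ofReal_le_ofReal
      (sq_le_sq.2 (abs_abs_sub_abs_le_abs_sub _ _))
  have hD0 : 0 ≤ ∫ t in Ioi 0, (∫ x, (g (x + t) - g x) ^ 2) / t ^ 2 :=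
    integral_nonneg fun t => div_nonneg (hSnn t) (sq_nonneg t)
  have key := integral_pow_three_le_of_sub_translate_le (w := fun x => |g x|) hgc.abs hg.abs
    ((memLp_two_iff_integrable_sq hgc.abs.aestronglyMeasurable).2 (by simpa using hsq))
    (C := ENNReal.ofReal (2 * L * ∫ x, |g x|)) ENNReal.ofReal_ne_top (fun t ht => ?_)
    (D := (1 / Real.pi) * ∫ t in Ioi 0, (∫ x, (g (x + t) - g x) ^ 2) / t ^ 2)
    (mul_nonneg (by positivity) hD0) ?_
  · simpa only [sq_abs] using key
  · refine (habs t).trans ?_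
    rw [← ENNReal.ofReal_mul (sq_nonneg t)]
    refine ENNReal.ofReal_le_ofReal ?_
    rw [mul_comm]
    exact integral_sub_translate_sq_le hd hg hgc' hB hM hg' hL0 hL ht.le
  · rw [← mul_assoc, mul_one_div_cancel Real.pi_ne_zero, one_mul,
      ofReal_integral_eq_lintegral_ofReal
        (integrableOn_integral_sub_translate_sq_div hd hg hgc' hB hM hg' hL0 hL)
        (ae_of_all _ fun t => div_nonneg (hSnn t) (sq_nonneg t))]
    refine setLIntegral_mono' measurableSet_Ioi fun t ht => ?_
    rw [ENNReal.ofReal_div_of_pos (pow_pos ht 2)]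
    gcongr
    exact habs t

end

/-- Sharp Gagliardo–Nirenberg inequality for the BO nonlinearity (`m = 2`):
`‖v‖_{L³}³ ≤ (3/(2√π)) ‖D^{1/2}v‖_{L²} ‖v‖_{L²}²`, where
`‖D^{1/2}v‖_{L²}² = ∫ v · H(v')`.  The constant is sharp, attained by the
ground state `Q(x) = 4/(1+x²)`, which has `‖Q‖_{L²}² = 8π` so that
`C₂ = 3 √(2/(8π)) = 3/(2√π)`. -/
theorem BO_sharp_gagliardo_nirenberg (v : SchwartzMap ℝ ℝ) :
    (∀ x : ℝ, ∃ A : ℝ, HilbertPVR (deriv ⇑v) x A) ∧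
    (∀ Hv' : ℝ → ℝ, (∀ x : ℝ, HilbertPVR (deriv ⇑v) x (Hv' x)) →
      0 ≤ (∫ x : ℝ, v x * Hv' x) ∧
      ∫ x : ℝ, |v x| ^ 3 ≤
        (3 / (2 * Real.sqrt Real.pi)) * Real.sqrt (∫ x : ℝ, v x * Hv' x) *
          ∫ x : ℝ, (v x) ^ 2) ∧
    (∫ x : ℝ, (4 / (1 + x ^ 2)) ^ 2) = 8 * Real.pi ∧
    3 / (2 * Real.sqrt Real.pi) =
      (2 * 3 / 2) * Real.sqrt (2 / ((2 - 1) * (8 * Real.pi))) := by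
  have hcoe : ⇑(SchwartzMap.derivCLM ℝ ℝ v) = deriv v :=
    funext fun x => SchwartzMap.derivCLM_apply ℝ v x
  have hd := v.hasDerivAt
  have hg := v.integrable (μ := volume)
  have hgc' : Continuous (deriv v) := hcoe ▸ (SchwartzMap.derivCLM ℝ ℝ v).continuous
  have hg' : Integrable (deriv v) := hcoe ▸ (SchwartzMap.derivCLM ℝ ℝ v).integrable
  have hB : ∀ x, |v x| ≤ _ := fun x => v.norm_le_seminorm ℝ x
  have hM : ∀ x, |deriv v x| ≤ _ := fun x =>
    hcoe ▸ (SchwartzMap.derivCLM ℝ ℝ v).norm_le_seminorm ℝ x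
  have hL0 := apply_nonneg (SchwartzMap.seminorm ℝ 0 0)
    (SchwartzMap.derivCLM ℝ ℝ (SchwartzMap.derivCLM ℝ ℝ v))
  have hL := v.abs_deriv_sub_le
  have hPV := hilbertPVR_of_lipschitz hgc' hg' hL
  refine ⟨fun x => ⟨_, hPV x⟩, fun Hv' hHv' => ?_, integral_four_div_one_add_sq_sq,
    three_div_two_mul_sqrt_pi⟩
  have hD : ∫ x, v x * Hv' x =
      (1 / Real.pi) * ∫ t in Set.Ioi 0, (∫ x, (v (x + t) - v x) ^ 2) / t ^ 2 := by
    rw [← integral_mul_foldedKernel_eq hd hg hgc' hB hM hg' hL0 hL, ← integral_const_mul]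
    congr 1 with x
    rw [tendsto_nhds_unique (hHv' x) (hPV x)]
    ring
  rw [hD]
  refine ⟨mul_nonneg (by positivity) (integral_nonneg fun t =>
    div_nonneg (integral_nonneg fun x => sq_nonneg _) (sq_nonneg t)),
    integral_abs_pow_three_le hd hg hgc' hB hM hg' hL0 hL⟩
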